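/- Let A be a unital complex *-algebra, Ω an A-bimodule, and d : A → Ω a ℂ-linear map with d(ab) = d(a)·b + a·d(b) such that every element of Ω is a finite sum Σᵢ aᵢ·d(bᵢ). Assume the junk-symmetry condition: for all ∂₁,∂₂ ∈ D_ℂ and every finite family aᵢ,bᵢ ∈ A with Σᵢ aᵢ·d(bᵢ) = 0, one has Σᵢ ∂₁(aᵢ)·∂₂(bᵢ) = Σᵢ ∂₂(aᵢ)·∂₁(bᵢ). Then D_ℂ is closed under the commutator [∂₁,∂₂] = ∂₁∘∂₂ - ∂₂∘∂₁, i.e. D_ℂ is a complex Lie subalgebra of the derivations of A; moreover the subset D of Hermitian derivations in D_ℂ is closed under the commutator, so D is a real Lie subalgebra of the Hermitian derivations. -/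

import Mathlib

open MulOpposite

/-- Membership in `D_ℂ`: a ℂ-linear derivation `∂ : A → A` compatible with the
relations of the differential `d : A → Ω`. -/
def MemDC {A : Type*} [Ring A] [Algebra ℂ A] {Ω : Type*} [AddCommGroup Ω]
    [Module A Ω] [Module Aᵐᵒᵖ Ω] (d : A → Ω) (δ : A → A) : Prop :=
  (∀ a b : A, δ (a + b) = δ a + δ b) ∧
  (∀ (c : ℂ) (a : A), δ (c • a) = c • δ a) ∧
  (∀ a b : A, δ (a * b) = δ a * b + a * δ b) ∧
  (∀ (n : ℕ) (a b : Fin n → A), (∑ i, a i • d (b i)) = 0 → (∑ i, a i * δ (b i)) = 0)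

/-- Applying a derivation to a relation `∑ aᵢ · δ₂ bᵢ = 0` and expanding by the Leibniz rule. -/
theorem MemDC.sum_add_sum_eq_zero {A : Type*} [Ring A] [Algebra ℂ A] {Ω : Type*}
    [AddCommGroup Ω] [Module A Ω] [Module Aᵐᵒᵖ Ω] {d : A → Ω} {δ₁ δ₂ : A → A}
    (h₁ : MemDC d δ₁) (h₂ : MemDC d δ₂) {n : ℕ} {a b : Fin n → A}
    (h : ∑ i, a i • d (b i) = 0) :
    ∑ i, δ₁ (a i) * δ₂ (b i) + ∑ i, a i * δ₁ (δ₂ (b i)) = 0 := by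
  obtain ⟨hadd, -, hmul, -⟩ := h₁
  let f : A →+ A := AddMonoidHom.mk' δ₁ hadd
  have hf : f (∑ i, a i * δ₂ (b i)) = 0 := by rw [h₂.2.2.2 n a b h, map_zero]
  rw [map_sum] at hf
  simpa only [f, AddMonoidHom.mk'_apply, hmul, Finset.sum_add_distrib] using hf

/-- The commutator of two elements of `D_ℂ` lies in `D_ℂ` as soon as the pair satisfies the
junk-symmetry condition. -/
theorem MemDC.commutator {A : Type*} [Ring A] [Algebra ℂ A] {Ω : Type*}
    [AddCommGroup Ω] [Module A Ω] [Module Aᵐᵒᵖ Ω] {d : A → Ω} {δ₁ δ₂ : A → A}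
    (h₁ : MemDC d δ₁) (h₂ : MemDC d δ₂)
    (hjunk : ∀ (n : ℕ) (a b : Fin n → A), (∑ i, a i • d (b i)) = 0 →
      (∑ i, δ₁ (a i) * δ₂ (b i)) = (∑ i, δ₂ (a i) * δ₁ (b i))) :
    MemDC d (fun a => δ₁ (δ₂ a) - δ₂ (δ₁ a)) := by
  have ⟨hadd₁, hsmul₁, hmul₁, _⟩ := h₁
  have ⟨hadd₂, hsmul₂, hmul₂, _⟩ := h₂
  refine ⟨fun a b => ?_, fun c a => ?_, fun a b => ?_, fun n a b h => ?_⟩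
  · simp only [hadd₁, hadd₂]
    abel
  · simp only [hsmul₁, hsmul₂, smul_sub]
  · simp only [hmul₁, hmul₂, hadd₁, hadd₂]
    noncomm_ring
  · have h₁₂ := h₁.sum_add_sum_eq_zero h₂ h
    have h₂₁ := h₂.sum_add_sum_eq_zero h₁ h
    rw [← hjunk n a b h] at h₂₁
    simp only [mul_sub, Finset.sum_sub_distrib]
    exact sub_eq_zero.mpr (add_left_cancel (h₁₂.trans h₂₁.symm))

/-- Under the junk-symmetry condition, `D_ℂ` is closed under the
commutator of derivations (a complex Lie algebra), and the Hermitian derivations `D`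
in `D_ℂ` are closed under the commutator (a real Lie algebra). -/
theorem DC_closed_under_commutator
    {A : Type*} [Ring A] [Algebra ℂ A] [StarRing A] [StarModule ℂ A]
    {Ω : Type*} [AddCommGroup Ω] [Module A Ω] [Module Aᵐᵒᵖ Ω] [SMulCommClass A Aᵐᵒᵖ Ω]
    (d : A → Ω)
    (hd_add : ∀ a b : A, d (a + b) = d a + d b)
    (hd_smulC : ∀ (c : ℂ) (a : A), d (c • a) = algebraMap ℂ A c • d a)
    (hd_leibniz : ∀ a b : A, d (a * b) = op b • d a + a • d b)
    (hgen : ∀ v : Ω, ∃ (n : ℕ) (a b : Fin n → A), v = ∑ i, a i • d (b i))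
    -- junk-symmetry condition
    (hjunk : ∀ δ₁ δ₂ : A → A, MemDC d δ₁ → MemDC d δ₂ →
      ∀ (n : ℕ) (a b : Fin n → A), (∑ i, a i • d (b i)) = 0 →
        (∑ i, δ₁ (a i) * δ₂ (b i)) = (∑ i, δ₂ (a i) * δ₁ (b i))) :
    -- `D_ℂ` is closed under the commutator
    (∀ δ₁ δ₂ : A → A, MemDC d δ₁ → MemDC d δ₂ →
      MemDC d (fun a => δ₁ (δ₂ a) - δ₂ (δ₁ a))) ∧
    -- the Hermitian derivations in `D_ℂ` are closed under the commutator
    (∀ δ₁ δ₂ : A → A, MemDC d δ₁ → MemDC d δ₂ →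
      (∀ a : A, δ₁ (star a) = star (δ₁ a)) → (∀ a : A, δ₂ (star a) = star (δ₂ a)) →
      MemDC d (fun a => δ₁ (δ₂ a) - δ₂ (δ₁ a)) ∧
      ∀ a : A, δ₁ (δ₂ (star a)) - δ₂ (δ₁ (star a)) = star (δ₁ (δ₂ a) - δ₂ (δ₁ a))) := by
  have hcomm : ∀ δ₁ δ₂ : A → A, MemDC d δ₁ → MemDC d δ₂ →
      MemDC d (fun a => δ₁ (δ₂ a) - δ₂ (δ₁ a)) :=
    fun δ₁ δ₂ h₁ h₂ => h₁.commutator h₂ (hjunk δ₁ δ₂ h₁ h₂)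
  refine ⟨hcomm, fun δ₁ δ₂ h₁ h₂ hstar₁ hstar₂ => ⟨hcomm δ₁ δ₂ h₁ h₂, fun a => ?_⟩⟩
  simp only [hstar₁, hstar₂, star_sub]
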